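/- The ordinary differential equation x'(t) = 0.5 - 2·sign(x(t)) with initial condition x(0) = 1 does not admit a solution: there is no function x : ℝ → ℝ that is differentiable at every t ∈ [0, 1], satisfies x(0) = 1, and satisfies x'(t) = 0.5 - 2·sign(x(t)) for all t ∈ [0, 1]. -/

import Mathlib

/-- The ODE x'(t) = 0.5 - 2·sign(x(t)), x(0) = 1, has no solution on [0,1]:
there is no function `x : ℝ → ℝ` that is differentiable at every `t ∈ [0,1]`
with derivative `0.5 - 2 * Real.sign (x t)` there and satisfies `x 0 = 1`. -/
theorem no_solution_ode_sign :
    ¬ ∃ x : ℝ → ℝ, x 0 = 1 ∧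
      ∀ t ∈ Set.Icc (0 : ℝ) 1,
        HasDerivAt x (0.5 - 2 * Real.sign (x t)) t := by
  rintro ⟨x, h0, hx⟩
  -- The derivative omits the value `-1`, so by Darboux it stays below `-1`, and `x` stays positive.
  have hne : ∀ t ∈ Set.Icc (0 : ℝ) 1, 0.5 - 2 * Real.sign (x t) ≠ -1 := by
    intro t _
    rcases Real.sign_apply_eq (x t) with h | h | h <;> rw [h] <;> norm_num
  rcases hasDerivWithinAt_forall_lt_or_forall_gt_of_forall_ne (convex_Icc (0 : ℝ) 1)
    (fun t ht => (hx t ht).hasDerivWithinAt) hne with hlt | hgt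
  · have hsign : ∀ t ∈ Set.Icc (0 : ℝ) 1, Real.sign (x t) = 1 := by
      intro t ht
      have := hlt t ht
      rcases Real.sign_apply_eq (x t) with h | h | h
      · norm_num [h] at this
      · norm_num [h] at this
      · exact h
    obtain ⟨c, hc, hslope⟩ := exists_hasDerivAt_eq_slope x (fun t => 0.5 - 2 * Real.sign (x t))
      zero_lt_one (fun t ht => (hx t ht).continuousAt.continuousWithinAt)
      (fun t ht => hx t (Set.Ioo_subset_Icc_self ht))
    have hneg : x 1 < 0 := by
      rw [hsign c (Set.Ioo_subset_Icc_self hc), h0] at hslope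
      norm_num at hslope
      linarith
    have := hsign 1 (by simp)
    rw [Real.sign_of_neg hneg] at this
    norm_num at this
  · have := hgt 0 (by simp)
    norm_num [h0, Real.sign_one] at this
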